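/- Let n, k ≥ 1, set l = 2n+2k+2, let s ∈ ℂ be a primitive 2l-th root of unity, and let p ∈ ℤ. For m ≥ 1 and a partition λ with at most m parts define Q_m(λ) = (−1)^{|λ|} ∏_{j=1}^{m} [2m+2+2λ_j−2j]_s/[2m+2−2j]_s · ∏_{1≤i<j≤m} [2m+2+λ_i−i+λ_j−j]_s·[λ_i−i−λ_j+j]_s / ([2m+2−i−j]_s·[j−i]_s), where [a]_s = s^a − s^{−a}. Then ∑_{λ: λ_1 ≤ k, at most n parts} Q_n(λ)^p = ∑_{μ: μ_1 ≤ n, at most k parts} Q_k(μ)^p, where negative integer powers denote inverses in ℂ (all Q_n(λ), Q_k(μ) occurring are nonzero). -/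

import Mathlib

open Finset

/-- `[m]_s = s^m - s^{-m}`. -/
noncomputable def br (s : ℂ) (m : ℤ) : ℂ := s ^ m - s ^ (-m)

/-- The quantum dimension `Q(λ)` of the simple object of `C^{n,k}` labelled by the
partition `λ = (λ_1,…,λ_n)` (here `f : Fin n → ℕ` with `f j = λ_{j+1}`):
`Q(λ) = (-1)^{|λ|} ∏_{j=1}^n [2n+2+2λ_j-2j]/[2n+2-2j] ·
∏_{1≤i<j≤n} [2n+2+λ_i-i+λ_j-j]·[λ_i-i-λ_j+j] / ([2n+2-i-j]·[j-i])`. -/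
noncomputable def Qdim (s : ℂ) (n : ℕ) (f : Fin n → ℕ) : ℂ :=
  (-1 : ℂ) ^ (∑ j, f j) *
  (∏ j : Fin n,
    br s (2 * n + 2 + 2 * (f j : ℤ) - 2 * ((j : ℕ) + 1)) /
      br s (2 * n + 2 - 2 * (((j : ℕ) : ℤ) + 1))) *
  ∏ p ∈ (Finset.univ ×ˢ Finset.univ : Finset (Fin n × Fin n)).filter (fun p => p.1 < p.2),
    br s (2 * n + 2 + (f p.1 : ℤ) - ((p.1 : ℕ) + 1) + (f p.2 : ℤ) - ((p.2 : ℕ) + 1)) *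
      br s ((f p.1 : ℤ) - ((p.1 : ℕ) + 1) - (f p.2 : ℤ) + ((p.2 : ℕ) + 1)) /
    (br s (2 * n + 2 - (((p.1 : ℕ) : ℤ) + 1) - (((p.2 : ℕ) : ℤ) + 1)) *
      br s ((((p.2 : ℕ) : ℤ) + 1) - (((p.1 : ℕ) : ℤ) + 1)))

/-- The labelling set `Γ = Γ(C^{n,k})`: partitions with at most `n` parts, each `≤ k`. -/
noncomputable def GammaC (n k : ℕ) : Finset (Fin n → ℕ) :=
  (Finset.Icc 0 (fun _ => k)).filter (fun f => ∀ i j : Fin n, i ≤ j → f j ≤ f i)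

/-- quantum factorial -/
noncomputable def qfac (s : ℂ) (m : ℕ) : ℂ := ∏ i ∈ range m, br s ((i : ℤ) + 1)

noncomputable def vv (s : ℂ) (a b : ℕ) : ℂ :=
  if b < a then br s ((a : ℤ) + b) * br s ((a : ℤ) - b) else 1

noncomputable def FF (s : ℂ) (A : Finset ℕ) : ℂ :=
  (∏ a ∈ A, br s (2 * (a : ℤ))) * ∏ a ∈ A, ∏ b ∈ A, vv s a b

lemma qfac_succ (s : ℂ) (m : ℕ) : qfac s (m + 1) = qfac s m * br s ((m : ℤ) + 1) := by
  simp [qfac, prod_range_succ]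

lemma br_ne (s : ℂ) (l : ℕ) (hs : IsPrimitiveRoot s (2 * l)) (m : ℤ) (h0 : 0 < m) (h1 : m < l) :
    br s m ≠ 0 := by
  have hl : 2 * l ≠ 0 := by omega
  have s0 : s ≠ 0 := hs.ne_zero hl
  intro h
  unfold br at h
  have h2 : s ^ (2 * m) = 1 := by
    have : s ^ m = s ^ (-m) := sub_eq_zero.mp h
    rw [two_mul, zpow_add₀ s0]
    nth_rewrite 2 [this]
    rw [← zpow_add₀ s0]; simp
  rw [hs.zpow_eq_one_iff_dvd] at h2
  have := Int.le_of_dvd (by omega) h2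
  push_cast at this
  omega

lemma s_pow_l (s : ℂ) (l : ℕ) (hl : l ≠ 0) (hs : IsPrimitiveRoot s (2 * l)) :
    s ^ (l : ℤ) = -1 := by
  have h1 : (s ^ l) ^ 2 = 1 := by rw [← pow_mul, mul_comm, hs.pow_eq_one]
  have h2 : s ^ l ≠ 1 := hs.pow_ne_one_of_pos_of_lt hl (by omega)
  rw [zpow_natCast]
  rcases eq_or_eq_neg_of_sq_eq_sq (s ^ l) 1 (by rw [h1, one_pow]) with h | h <;> simp_all

lemma br_refl (s : ℂ) (l : ℕ) (hl : l ≠ 0) (hs : IsPrimitiveRoot s (2 * l)) (m : ℤ) :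
    br s (l - m) = br s m := by
  have s0 : s ≠ 0 := hs.ne_zero (by omega)
  have h := s_pow_l s l hl hs
  have h' : s ^ (-(l : ℤ)) = -1 := by rw [zpow_neg, h]; norm_num
  unfold br
  rw [show -((l : ℤ) - m) = -l + m by ring, show (l : ℤ) - m = l + -m by ring, zpow_add₀ s0, zpow_add₀ s0, h, h']
  ring

lemma prod_low (s : ℂ) (a M : ℕ) (h : M + 1 ≤ a) :
    (∏ t ∈ Icc 1 M, vv s a t * vv s t a) * qfac s a * qfac s (a - 1 - M)
      = qfac s (a + M) * qfac s (a - 1) := by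
  induction M with
  | zero => simp
  | succ M ih =>
    have ih := ih (by omega)
    rw [Finset.prod_Icc_succ_top (by omega), ← add_assoc, qfac_succ]
    obtain ⟨d, rfl⟩ : ∃ d, a = M + 2 + d := ⟨a - (M + 2), by omega⟩
    rw [show M + 2 + d - 1 - M = d + 1 by omega, qfac_succ] at ih
    rw [show M + 2 + d - 1 - (M + 1) = d by omega]
    have e1 : vv s (M + 2 + d) (M + 1) = br s (((M + 2 + d + M : ℕ) : ℤ) + 1) * br s ((d : ℤ) + 1) := by
      rw [vv, if_pos (by omega)]
      congr 2 <;> push_cast <;> ring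
    have e2 : vv s (M + 1) (M + 2 + d) = 1 := by
      rw [vv, if_neg (by omega)]
    rw [e1, e2]
    linear_combination br s (((M + 2 + d + M : ℕ) : ℤ) + 1) * ih

lemma prod_high (s : ℂ) (a d : ℕ) (h : 1 ≤ a) :
    br s (2 * (a : ℤ)) * (∏ t ∈ Icc 1 (a + d), vv s a t * vv s t a) * qfac s a
      = qfac s (a + (a + d)) * qfac s d * qfac s (a - 1) := by
  induction d with
  | zero =>
    obtain ⟨b, rfl⟩ : ∃ b, a = b + 1 := ⟨a - 1, by omega⟩
    have := prod_low s (b + 1) b le_rfl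
    rw [add_zero, Finset.prod_Icc_succ_top (by omega), ← add_assoc, qfac_succ s (b + 1 + b)]
    have e1 : vv s (b + 1) (b + 1) = 1 := by simp [vv]
    have e2 : br s (2 * ((b + 1 : ℕ) : ℤ)) = br s (((b + 1 + b : ℕ) : ℤ) + 1) := by
      congr 1; push_cast; ring
    have e3 : qfac s 0 = 1 := by simp [qfac]
    rw [show b + 1 - 1 - b = 0 by omega] at this
    rw [e3] at this
    rw [e1, e2, e3]
    linear_combination br s (((b + 1 + b : ℕ) : ℤ) + 1) * this
  | succ d ih =>
    rw [← add_assoc, Finset.prod_Icc_succ_top (by omega), ← add_assoc, qfac_succ, qfac_succ]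
    have e2 : vv s a (a + d + 1) = 1 := by
      rw [vv, if_neg (by omega)]
    have e1 : vv s (a + d + 1) a = br s (((a + (a + d) : ℕ) : ℤ) + 1) * br s ((d : ℤ) + 1) := by
      rw [vv, if_pos (by omega)]
      congr 2 <;> push_cast <;> ring
    rw [e1, e2]
    linear_combination br s (((a + (a + d) : ℕ) : ℤ) + 1) * br s ((d : ℤ) + 1) * ih

lemma qfac_ne (s : ℂ) (l : ℕ) (hs : IsPrimitiveRoot s (2 * l)) (m : ℕ) (h : m < l) :
    qfac s m ≠ 0 := by
  unfold qfac
  rw [prod_ne_zero_iff]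
  intro i hi
  rw [mem_range] at hi
  exact br_ne s l hs _ (by omega) (by omega)

lemma qfac_refl (s : ℂ) (l : ℕ) (hl : l ≠ 0) (hs : IsPrimitiveRoot s (2 * l)) (m r : ℕ)
    (h : m + r + 1 = l) : qfac s m * qfac s r = qfac s (m + r) := by
  have : ∀ j ≤ r, qfac s (m + r - j) * qfac s j = qfac s (m + r) := by
    intro j
    induction j with
    | zero => simp [qfac]
    | succ j ih =>
      intro hj
      rw [← ih (by omega)]
      obtain ⟨q, hq⟩ : ∃ q, m + r - j = q + 1 := ⟨m + r - j - 1, by omega⟩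
      rw [show m + r - (j + 1) = q by omega, hq, qfac_succ, qfac_succ]
      have : br s ((j : ℤ) + 1) = br s ((q : ℤ) + 1) := by
        rw [← br_refl s l hl hs]
        congr 1; omega
      rw [this]; ring
  simpa using this r le_rfl

lemma E_const (s : ℂ) (N : ℕ) (hs : IsPrimitiveRoot s (2 * (2 * N + 2))) (a : ℕ)
    (h1 : 1 ≤ a) (h2 : a ≤ N) :
    br s (2 * (a : ℤ)) ^ 2 * ∏ t ∈ Icc 1 N, vv s a t * vv s t a
      = qfac s (2 * N + 1) / s ^ ((N : ℤ) + 1) := by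
  obtain ⟨d, rfl⟩ : ∃ d, N = a + d := ⟨N - a, by omega⟩
  have hh := prod_high s a d h1
  have s0 : s ≠ 0 := hs.ne_zero (by omega)
  obtain ⟨b, rfl⟩ : ∃ b, a = b + 1 := ⟨a - 1, by omega⟩
  have hr := qfac_refl s _ (by omega) hs (b + 1 + (b + 1 + d) + 1) d (by omega)
  rw [qfac_succ s b] at hh
  rw [qfac_succ, show b + 1 + (b + 1 + d) + 1 + d = 2 * (b + 1 + d) + 1 by omega] at hr
  rw [show b + 1 - 1 = b by omega] at hh
  have n1 := qfac_ne s _ hs b (by omega)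
  have n2 := br_ne s _ hs ((b : ℤ) + 1) (by omega) (by omega)
  have hl := s_pow_l s _ (by omega) hs
  have key : br s (2 * ((b + 1 : ℕ) : ℤ)) * s ^ (((b + 1 + d : ℕ) : ℤ) + 1)
      = br s ((b : ℤ) + 1) * br s (((b + 1 + (b + 1 + d) : ℕ) : ℤ) + 1) := by
    set i := s ^ (((b + 1 + d : ℕ) : ℤ) + 1) with hi
    have i2 : i * i = -1 := by
      rw [← hl, hi, ← zpow_add₀ s0]; congr 1; push_cast; ring
    have i0 : i ≠ 0 := by rw [hi]; exact zpow_ne_zero _ s0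
    have ii : i⁻¹ = -i := by
      apply mul_left_cancel₀ i0
      rw [mul_inv_cancel₀ i0]
      linear_combination i2
    have x0 : s ^ ((b : ℤ) + 1) ≠ 0 := zpow_ne_zero _ s0
    unfold br
    have e1 : s ^ (((b + 1 + (b + 1 + d) : ℕ) : ℤ) + 1) = s ^ ((b : ℤ) + 1) * i := by
      rw [hi, ← zpow_add₀ s0]; congr 1
    have e2 : s ^ (2 * ((b + 1 : ℕ) : ℤ)) = s ^ ((b : ℤ) + 1) * s ^ ((b : ℤ) + 1) := by
      rw [← zpow_add₀ s0]; congr 1; push_cast; ring_nf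
    rw [zpow_neg, zpow_neg, zpow_neg, e1, e2, mul_inv, mul_inv, ii]
    field_simp
    ring
  rw [eq_div_iff (zpow_ne_zero _ s0)]
  apply mul_right_cancel₀ n1
  apply mul_right_cancel₀ n2
  set X := ∏ t ∈ Icc 1 (b + 1 + d), vv s (b + 1) t * vv s t (b + 1)
  set i := s ^ (((b + 1 + d : ℕ) : ℤ) + 1)
  linear_combination br s (2 * ((b + 1 : ℕ) : ℤ)) * i * hh
    + qfac s (b + 1 + (b + 1 + d)) * qfac s d * qfac s b * key
    + qfac s b * br s ((b : ℤ) + 1) * hr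

lemma FF_sq (s : ℂ) (N : ℕ) (hs : IsPrimitiveRoot s (2 * (2 * N + 2))) (A : Finset ℕ)
    (hA : A ⊆ Icc 1 N) :
    FF s A * FF s (Icc 1 N) = FF s (Icc 1 N \ A) * 
      (qfac s (2 * N + 1) / s ^ ((N : ℤ) + 1)) ^ A.card := by
  set C := Icc 1 N \ A with hC
  set K := qfac s (2 * N + 1) / s ^ ((N : ℤ) + 1)
  have hd : Disjoint A C := disjoint_sdiff
  have hT : Icc 1 N = A ∪ C := (union_sdiff_of_subset hA).symm
  have h1 : ∏ a ∈ A, (br s (2 * (a : ℤ)) ^ 2 * ∏ t ∈ Icc 1 N, vv s a t * vv s t a) = K ^ A.card := by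
    apply prod_eq_pow_card
    intro a ha
    have := mem_Icc.mp (hA ha)
    exact E_const s N hs a this.1 this.2
  rw [← h1]
  simp only [FF, hT, prod_union hd, prod_mul_distrib, prod_pow]
  rw [prod_comm (s := A) (t := A) (f := fun x y => vv s y x),
    prod_comm (s := A) (t := C) (f := fun x y => vv s y x)]
  ring

lemma FF_ne (s : ℂ) (N : ℕ) (hs : IsPrimitiveRoot s (2 * (2 * N + 2))) (A : Finset ℕ)
    (hA : A ⊆ Icc 1 N) : FF s A ≠ 0 := by
  unfold FF
  refine mul_ne_zero (prod_ne_zero_iff.mpr fun a ha => ?_)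
    (prod_ne_zero_iff.mpr fun a ha => prod_ne_zero_iff.mpr fun b hb => ?_)
  · have := mem_Icc.mp (hA ha)
    exact br_ne s _ hs _ (by omega) (by omega)
  · have := mem_Icc.mp (hA ha)
    have := mem_Icc.mp (hA hb)
    unfold vv
    split_ifs with h
    · exact mul_ne_zero (br_ne s _ hs _ (by omega) (by omega)) (br_ne s _ hs _ (by omega) (by omega))
    · exact one_ne_zero

/-- reflection of a finset -/
def reflSet (N : ℕ) (A : Finset ℕ) : Finset ℕ := A.image (fun a => N + 1 - a)

lemma injOn_refl (N : ℕ) (A : Finset ℕ) (hA : A ⊆ Icc 1 N) :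
    Set.InjOn (fun a => N + 1 - a) (A : Set ℕ) := by
  intro a ha b hb h
  have := mem_Icc.mp (hA ha)
  have := mem_Icc.mp (hA hb)
  simp only at h
  omega

lemma FF_refl (s : ℂ) (N : ℕ) (hs : IsPrimitiveRoot s (2 * (2 * N + 2))) (A : Finset ℕ)
    (hA : A ⊆ Icc 1 N) : FF s (reflSet N A) = FF s A := by
  have hi := injOn_refl N A hA
  unfold FF reflSet
  rw [prod_image hi, prod_image hi]
  congr 1
  · apply prod_congr rfl
    intro a ha
    have := mem_Icc.mp (hA ha)
    rw [← br_refl s _ (by omega) hs]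
    congr 1
    push_cast [Nat.cast_sub (show a ≤ N + 1 by omega)]
    ring
  · rw [prod_comm]
    rw [prod_image hi]
    apply prod_congr rfl
    intro a ha
    apply prod_congr rfl
    intro b hb
    have := mem_Icc.mp (hA ha)
    have := mem_Icc.mp (hA hb)
    unfold vv
    by_cases h : b < a
    · rw [if_pos h, if_pos (by omega), ← br_refl s _ (by omega) hs]
      congr 2
      · push_cast [Nat.cast_sub (show a ≤ N + 1 by omega), Nat.cast_sub (show b ≤ N + 1 by omega)]
        ring
      · push_cast [Nat.cast_sub (show a ≤ N + 1 by omega), Nat.cast_sub (show b ≤ N + 1 by omega)]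
        ring
    · rw [if_neg h, if_neg (by omega)]

noncomputable def GG (s : ℂ) (n : ℕ) (A : Finset ℕ) : ℂ :=
  (-1 : ℂ) ^ (∑ a ∈ A, a + ∑ a ∈ Icc 1 n, a) * (FF s A / FF s (Icc 1 n))

def dual (N : ℕ) (A : Finset ℕ) : Finset ℕ := reflSet N (Icc 1 N \ A)

lemma mem_dual (N : ℕ) (A : Finset ℕ) (x : ℕ) :
    x ∈ dual N A ↔ (1 ≤ x ∧ x ≤ N) ∧ N + 1 - x ∉ A := by
  simp only [dual, reflSet, mem_image, mem_sdiff, mem_Icc]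
  constructor
  · rintro ⟨a, ⟨h1, h2⟩, rfl⟩
    refine ⟨by omega, ?_⟩
    rwa [show N + 1 - (N + 1 - a) = a by omega]
  · rintro ⟨h1, h2⟩
    exact ⟨N + 1 - x, ⟨by omega, h2⟩, by omega⟩

lemma dual_dual (N : ℕ) (A : Finset ℕ) (hA : A ⊆ Icc 1 N) : dual N (dual N A) = A := by
  ext x
  rw [mem_dual, mem_dual]
  constructor
  · rintro ⟨h1, h2⟩
    by_contra h
    apply h2
    refine ⟨by omega, ?_⟩
    rwa [show N + 1 - (N + 1 - x) = x by omega]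
  · intro h
    have := mem_Icc.mp (hA h)
    refine ⟨this, fun h2 => h2.2 ?_⟩
    rwa [show N + 1 - (N + 1 - x) = x by omega]

lemma dual_card (N : ℕ) (A : Finset ℕ) (hA : A ⊆ Icc 1 N) : (dual N A).card = N - A.card := by
  unfold dual reflSet
  rw [card_image_of_injOn (injOn_refl N _ sdiff_subset), card_sdiff_of_subset hA]
  simp

lemma dual_sub (N : ℕ) (A : Finset ℕ) : dual N A ⊆ Icc 1 N := by
  intro x hx
  rw [mem_dual] at hx
  exact mem_Icc.mpr hx.1

lemma dual_base (n k : ℕ) : dual (n + k) (Icc 1 n) = Icc 1 k := by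
  ext x
  rw [mem_dual, mem_Icc, mem_Icc]
  omega

lemma dual_sum (N : ℕ) (A : Finset ℕ) (hA : A ⊆ Icc 1 N) :
    ∑ a ∈ dual N A, a + ∑ a ∈ Icc 1 N, a = (N - A.card) * (N + 1) + ∑ a ∈ A, a := by
  rw [← sum_sdiff hA, ← add_assoc]
  congr 1
  unfold dual reflSet
  rw [sum_image (injOn_refl N _ sdiff_subset), ← sum_add_distrib]
  rw [sum_const_nat (m := N + 1)]
  · rw [card_sdiff_of_subset hA]; simp
  · intro x hx
    have := mem_Icc.mp (mem_sdiff.mp hx).1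
    omega

lemma GG_dual (s : ℂ) (n k : ℕ) (hs : IsPrimitiveRoot s (2 * (2 * (n + k) + 2))) (A : Finset ℕ)
    (hA : A ⊆ Icc 1 (n + k)) (hc : A.card = n) : GG s k (dual (n + k) A) = GG s n A := by
  have hB : Icc 1 n ⊆ Icc 1 (n + k) := Icc_subset_Icc le_rfl (by omega)
  have hBc : (Icc 1 n).card = n := by simp
  unfold GG
  rw [← dual_base n k]
  congr 1
  · have h1 := dual_sum _ _ hA
    have h2 := dual_sum _ _ hB
    rw [hc] at h1
    rw [hBc] at h2
    rw [neg_one_pow_eq_pow_mod_two, neg_one_pow_eq_pow_mod_two (n := ∑ a ∈ A, a + _)]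
    congr 1
    omega
  · have h1 := FF_sq s _ hs _ hA
    have h2 := FF_sq s _ hs _ hB
    rw [hc] at h1
    rw [hBc] at h2
    unfold dual
    rw [FF_refl s _ hs _ sdiff_subset, FF_refl s _ hs _ sdiff_subset]
    have n1 := FF_ne s _ hs _ hB
    have n2 := FF_ne s _ hs (Icc 1 (n + k) \ Icc 1 n) sdiff_subset
    have n3 := FF_ne s _ hs _ (subset_refl (Icc 1 (n + k)))
    have n4 := FF_ne s _ hs _ hA
    set K := (qfac s (2 * (n + k) + 1) / s ^ (((n + k : ℕ) : ℤ) + 1)) ^ n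
    have n5 : K ≠ 0 := by
      intro h
      rw [h, mul_zero] at h2
      exact mul_ne_zero n1 n3 h2
    rw [div_eq_div_iff n2 n1]
    apply mul_right_cancel₀ n5
    apply mul_right_cancel₀ n3
    linear_combination FF s A * FF s (Icc 1 (n + k)) * h2 - FF s (Icc 1 n) * FF s (Icc 1 (n+k)) * h1

lemma sum_dual (s : ℂ) (n k : ℕ) (hs : IsPrimitiveRoot s (2 * (2 * (n + k) + 2))) (p : ℤ) :
    ∑ A ∈ powersetCard n (Icc 1 (n + k)), GG s n A ^ p
      = ∑ A ∈ powersetCard k (Icc 1 (n + k)), GG s k A ^ p := by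
  refine sum_nbij' (dual (n + k)) (dual (n + k)) ?_ ?_ ?_ ?_ ?_
  · intro A hA
    rw [mem_powersetCard] at hA ⊢
    exact ⟨dual_sub _ _, by rw [dual_card _ _ hA.1]; omega⟩
  · intro A hA
    rw [mem_powersetCard] at hA ⊢
    exact ⟨dual_sub _ _, by rw [dual_card _ _ hA.1]; omega⟩
  · intro A hA
    rw [mem_powersetCard] at hA
    exact dual_dual _ _ hA.1
  · intro A hA
    rw [mem_powersetCard] at hA
    exact dual_dual _ _ hA.1
  · intro A hA
    rw [mem_powersetCard] at hA
    rw [GG_dual s n k hs A hA.1 hA.2]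

/-- shifted parts -/
def sh {n : ℕ} (f : Fin n → ℕ) (j : Fin n) : ℕ := f j + (n - j)

def toSet {n : ℕ} (f : Fin n → ℕ) : Finset ℕ := univ.image (sh f)

lemma sh_lt {n : ℕ} (f : Fin n → ℕ) (hf : ∀ i j : Fin n, i ≤ j → f j ≤ f i) (i j : Fin n)
    (h : i < j) : sh f j < sh f i := by
  unfold sh
  have := hf i j h.le
  have : (i : ℕ) < j := h
  omega

lemma sh_inj {n : ℕ} (f : Fin n → ℕ) (hf : ∀ i j : Fin n, i ≤ j → f j ≤ f i) :
    Function.Injective (sh f) := by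
  have : StrictAnti (sh f) := fun i j h => sh_lt f hf i j h
  exact this.injective

lemma FF_toSet (s : ℂ) {n : ℕ} (f : Fin n → ℕ) (hf : ∀ i j : Fin n, i ≤ j → f j ≤ f i) :
    FF s (toSet f) = (∏ j, br s (2 * (sh f j : ℤ))) *
      ∏ p ∈ (Finset.univ ×ˢ Finset.univ : Finset (Fin n × Fin n)).filter (fun p => p.1 < p.2),
        br s ((sh f p.1 : ℤ) + sh f p.2) * br s ((sh f p.1 : ℤ) - sh f p.2) := by
  unfold FF toSet
  have hi := (sh_inj f hf).injOn (s := ((univ : Finset (Fin n)) : Set (Fin n)))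
  simp only [prod_image hi]
  congr 1
  rw [prod_filter, prod_product]
  apply prod_congr rfl
  intro i _
  apply prod_congr rfl
  intro j _
  unfold vv
  by_cases h : i < j
  · rw [if_pos h, if_pos (sh_lt f hf i j h)]
  · rw [if_neg h, if_neg]
    have : StrictAnti (sh f) := fun i j h => sh_lt f hf i j h
    rwa [this.lt_iff_gt]

lemma toSet_zero (n : ℕ) : toSet (fun _ : Fin n => 0) = Icc 1 n := by
  ext x
  simp only [toSet, sh, mem_image, mem_univ, true_and, mem_Icc]
  constructor
  · rintro ⟨j, rfl⟩
    have := j.2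
    omega
  · intro h
    exact ⟨⟨n - x, by omega⟩, by simp; omega⟩

lemma Qdim_eq (s : ℂ) (n : ℕ) (f : Fin n → ℕ) (hf : ∀ i j : Fin n, i ≤ j → f j ≤ f i) :
    Qdim s n f = GG s n (toSet f) := by
  have h0 : ∀ i j : Fin n, i ≤ j → (fun _ : Fin n => 0) j ≤ (fun _ : Fin n => 0) i :=
    fun _ _ _ => le_rfl
  have hsum : ∑ a ∈ toSet f, a = ∑ j, f j + ∑ a ∈ Icc 1 n, a := by
    rw [← toSet_zero n]
    unfold toSet
    rw [sum_image (sh_inj f hf).injOn, sum_image (sh_inj _ h0).injOn, ← sum_add_distrib]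
    simp [sh]
  unfold GG
  rw [hsum, ← toSet_zero n, FF_toSet s f hf, FF_toSet s _ h0]
  unfold Qdim
  rw [mul_div_mul_comm, ← prod_div_distrib, ← prod_div_distrib, mul_assoc, add_assoc, pow_add,
    ← two_mul, pow_mul]
  have hsh : ∀ (g : Fin n → ℕ) (j : Fin n), ((sh g j : ℕ) : ℤ) = g j + n - (j : ℕ) := by
    intro g j
    have := j.2
    unfold sh
    omega
  simp only [hsh]
  congr 1
  · simp
  congr 1
  · apply prod_congr rfl
    intro j _
    congr 2 <;> push_cast <;> ring
  · apply prod_congr rfl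
    intro p _
    congr 1 <;> congr 2 <;> push_cast <;> ring

lemma sum_Gamma (s : ℂ) (n k : ℕ) (p : ℤ) :
    ∑ f ∈ GammaC n k, Qdim s n f ^ p = ∑ A ∈ powersetCard n (Icc 1 (n + k)), GG s n A ^ p := by
  have hmem : ∀ f, f ∈ GammaC n k ↔ (∀ i, f i ≤ k) ∧ ∀ i j : Fin n, i ≤ j → f j ≤ f i := by
    intro f
    simp [GammaC, Pi.le_def]
  have hcard : ∀ f ∈ GammaC n k, (toSet f).card = n := by
    intro f hf
    rw [hmem] at hf
    unfold toSet
    rw [card_image_of_injective _ (sh_inj f hf.2)]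
    simp
  refine sum_bij (fun f _ => toSet f) ?_ ?_ ?_ ?_
  · intro f hf
    rw [mem_powersetCard]
    refine ⟨?_, hcard f hf⟩
    rw [hmem] at hf
    intro x hx
    simp only [toSet, mem_image, mem_univ, true_and] at hx
    obtain ⟨j, rfl⟩ := hx
    have := hf.1 j
    have := j.2
    rw [mem_Icc]
    unfold sh
    omega
  · intro f hf g hg h
    have key : ∀ (f : Fin n → ℕ) (hf : f ∈ GammaC n k) (A : Finset ℕ) (hA : A.card = n)
        (h : toSet f = A),
        (fun j => sh f (Fin.rev j)) = A.orderEmbOfFin hA := by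
      intro f hf A hA h
      apply orderEmbOfFin_unique
      · intro x
        rw [← h]
        exact mem_image_of_mem _ (mem_univ _)
      · intro i j hij
        exact sh_lt f ((hmem f).mp hf).2 _ _ (Fin.rev_lt_rev.mpr hij)
    have h1 := key f hf _ (hcard g hg) h
    have h2 := key g hg _ (hcard g hg) rfl
    have h3 := h1.trans h2.symm
    funext j
    have := congrFun h3 (Fin.rev j)
    simp only [Fin.rev_rev, sh] at this
    omega
  · intro A hA
    rw [mem_powersetCard] at hA
    obtain ⟨hA, hc⟩ := hA
    set e := A.orderEmbOfFin hc with he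
    have hstep : ∀ i j : Fin n, i ≤ j → e i + ((j : ℕ) - i) ≤ e j := by
      intro i j hij
      obtain ⟨j, hj⟩ := j
      induction j with
      | zero =>
        have : i = ⟨0, hj⟩ := le_antisymm hij (by simp [Fin.le_def])
        rw [this]; simp
      | succ j ih =>
        rcases hij.lt_or_eq with h | h
        · have h' : (i : ℕ) < j + 1 := h
          have := ih (by omega) (by rw [Fin.le_def]; simp; omega)
          have h2 : e ⟨j, by omega⟩ < e ⟨j + 1, hj⟩ := e.strictMono (by simp)
          simp only at this ⊢
          omega
        · rw [h]; simp
    have hrange : ∀ i, 1 ≤ e i ∧ e i ≤ n + k := fun i =>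
      mem_Icc.mp (hA (orderEmbOfFin_mem A hc i))
    have hlo : ∀ i : Fin n, (i : ℕ) + 1 ≤ e i := by
      intro i
      have h1 := hstep ⟨0, i.pos⟩ i (by simp [Fin.le_def])
      have h2 := (hrange ⟨0, i.pos⟩).1
      simp only at h1
      omega
    have hhi : ∀ i : Fin n, e i ≤ i + 1 + k := by
      intro i
      have hi := i.2
      have h1 := hstep i ⟨n - 1, by omega⟩ (by rw [Fin.le_def]; simp; omega)
      have h2 := (hrange ⟨n - 1, by omega⟩).2
      simp only at h1
      omega
    have hsh : ∀ j, sh (fun j : Fin n => e (Fin.rev j) - (n - j)) j = e (Fin.rev j) := by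
      intro j
      have := hlo (Fin.rev j)
      rw [Fin.val_rev] at this
      have := j.2
      simp only [sh]
      omega
    refine ⟨fun j => e (Fin.rev j) - (n - j), ?_, ?_⟩
    · rw [hmem]
      constructor
      · intro j
        have := hhi (Fin.rev j)
        rw [Fin.val_rev] at this
        omega
      · intro i j hij
        have h1 := hstep (Fin.rev j) (Fin.rev i) (Fin.rev_le_rev.mpr hij)
        have h2 : (i : ℕ) ≤ j := hij
        have h3 := hlo (Fin.rev j)
        rw [Fin.val_rev, Fin.val_rev] at h1
        rw [Fin.val_rev] at h3
        have := j.2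
        omega
    · apply eq_of_subset_of_card_le
      · intro x hx
        simp only [toSet, mem_image, mem_univ, true_and, hsh] at hx
        obtain ⟨j, rfl⟩ := hx
        exact orderEmbOfFin_mem A hc _
      · unfold toSet
        rw [hc, card_image_of_injective]
        · simp
        · intro a b hab
          rw [hsh, hsh] at hab
          exact Fin.rev_injective (e.injective hab)
  · intro f hf
    rw [Qdim_eq s n f ((hmem f).mp hf).2]

/-- Level-rank duality for power sums of quantum dimensions:
for every `p ∈ ℤ`, `∑_{λ_1 ≤ k, ≤ n parts} Q_n(λ)^p = ∑_{μ_1 ≤ n, ≤ k parts} Q_k(μ)^p`,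
where `s` is a primitive `2l`-th root of unity, `l = 2n+2k+2`. -/
theorem level_rank_power_sums (n k : ℕ) (hn : 1 ≤ n) (hk : 1 ≤ k)
    (s : ℂ) (hs : IsPrimitiveRoot s (2 * (2 * n + 2 * k + 2))) (p : ℤ) :
    ∑ f ∈ GammaC n k, Qdim s n f ^ p = ∑ f ∈ GammaC k n, Qdim s k f ^ p := by
  rw [sum_Gamma, sum_Gamma, add_comm k n]
  apply sum_dual
  rwa [mul_add 2 n k]
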